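/- If μ : M → X is a CM-preenvelope of the finitely generated R-module M (so X is maximal Cohen–Macaulay), then the dual map μ† : X† → M† is a CM-precover of M†. -/

import Mathlib

open CategoryTheory

noncomputable section

/-- `Ext^n_A(M, N)` as a module. -/
def ext1 (A : Type) [CommRing A] (n : ℕ) (M N : Type) [AddCommGroup M] [Module A M]
    [AddCommGroup N] [Module A N] : ModuleCat A :=
  ((Ext A (ModuleCat A) n).obj (Opposite.op (ModuleCat.of A M))).obj (ModuleCat.of A N)

/-- The depth of a module over a local ring: the least `n` with `Ext^n(k, M) ≠ 0`
(`⊤` if no such `n`, e.g. for the zero module). -/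
def rdepth (A : Type) [CommRing A] [IsLocalRing A] (M : Type) [AddCommGroup M] [Module A M] :
    ℕ∞ :=
  sInf {n : ℕ∞ | ∃ m : ℕ, n = m ∧ ¬ Subsingleton (ext1 A m (IsLocalRing.ResidueField A) M)}

/-- The dimension of a module, `dim M = dim (A / ann M)`. -/
def mdim (A : Type) [CommRing A] (M : Type) [AddCommGroup M] [Module A M] : WithBot ℕ∞ :=
  ringKrullDim (A ⧸ Module.annihilator A M)

/-- `cod M > n`, i.e. `dim A - dim M > n`, i.e. `dim M + n < d`. -/
def codGT (A : Type) [CommRing A] (d : ℕ) (M : Type) [AddCommGroup M] [Module A M]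
    (n : ℕ) : Prop :=
  mdim A M + n < (d : WithBot ℕ∞)

/-- `cod M ≥ n`, i.e. `dim M + n ≤ d`. -/
def codGE (A : Type) [CommRing A] (d : ℕ) (M : Type) [AddCommGroup M] [Module A M]
    (n : ℕ) : Prop :=
  mdim A M + n ≤ (d : WithBot ℕ∞)

/-- Maximal Cohen-Macaulay module over a `d`-dimensional local ring
(the zero module counts as MCM). -/
def IsMCM (A : Type) [CommRing A] [IsLocalRing A] (d : ℕ) (M : Type) [AddCommGroup M]
    [Module A M] : Prop :=
  Module.Finite A M ∧ (d : ℕ∞) ≤ rdepth A M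

/-- Serre's condition `(S_n)`: `depth M_p ≥ min {n, ht p}` for all primes `p`. -/
def SerreS (A : Type) [CommRing A] (n : ℕ) (M : Type) [AddCommGroup M] [Module A M] : Prop :=
  ∀ p : PrimeSpectrum A,
    min (n : WithBot ℕ∞) (ringKrullDim (Localization.AtPrime p.asIdeal))
      ≤ (rdepth (Localization.AtPrime p.asIdeal)
          (LocalizedModule p.asIdeal.primeCompl M) : ℕ∞)

/-- Finite injective dimension: `Ext^m(-, M)` vanishes for all large `m`. -/
def HasFID (A : Type) [CommRing A] (M : Type) [AddCommGroup M] [Module A M] : Prop :=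
  ∃ n : ℕ, ∀ (N : Type) [AddCommGroup N] [Module A N], ∀ m : ℕ, n < m →
    Subsingleton (ext1 A m N M)

/-- `ω` is a canonical module of the `d`-dimensional local ring `A`:
it is maximal Cohen-Macaulay, of finite injective dimension, and of type one. -/
def IsCanonicalModule (A : Type) [CommRing A] [IsLocalRing A] (d : ℕ) (ω : Type)
    [AddCommGroup ω] [Module A ω] : Prop :=
  IsMCM A d ω ∧ HasFID A ω ∧
    Nonempty ((ext1 A d (IsLocalRing.ResidueField A) ω) ≃ₗ[A] IsLocalRing.ResidueField A)

/-- `μ : M → X` is a CM-preenvelope. -/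
def IsCMPreenvelope (A : Type) [CommRing A] [IsLocalRing A] (d : ℕ) {M X : Type}
    [AddCommGroup M] [Module A M] [AddCommGroup X] [Module A X] (μ : M →ₗ[A] X) : Prop :=
  IsMCM A d X ∧ ∀ (Z : Type) [AddCommGroup Z] [Module A Z], IsMCM A d Z →
    ∀ f : M →ₗ[A] Z, ∃ g : X →ₗ[A] Z, g ∘ₗ μ = f

/-- `μ : M → X` is a special CM-preenvelope: a CM-preenvelope with
`Ext^1(coker μ, Z) = 0` for all maximal Cohen-Macaulay `Z`. -/
def IsSpecialCMPreenvelope (A : Type) [CommRing A] [IsLocalRing A] (d : ℕ) {M X : Type}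
    [AddCommGroup M] [Module A M] [AddCommGroup X] [Module A X] (μ : M →ₗ[A] X) : Prop :=
  IsCMPreenvelope A d μ ∧ ∀ (Z : Type) [AddCommGroup Z] [Module A Z], IsMCM A d Z →
    Subsingleton (ext1 A 1 (X ⧸ LinearMap.range μ) Z)

/-- `μ : M → X` is a CM-envelope. -/
def IsCMEnvelope (A : Type) [CommRing A] [IsLocalRing A] (d : ℕ) {M X : Type}
    [AddCommGroup M] [Module A M] [AddCommGroup X] [Module A X] (μ : M →ₗ[A] X) : Prop :=
  IsCMPreenvelope A d μ ∧ ∀ φ : X →ₗ[A] X, φ ∘ₗ μ = μ → Function.Bijective φ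

/-- `π : X → M` is a CM-precover. -/
def IsCMPrecover (A : Type) [CommRing A] [IsLocalRing A] (d : ℕ) {X M : Type}
    [AddCommGroup X] [Module A X] [AddCommGroup M] [Module A M] (π : X →ₗ[A] M) : Prop :=
  IsMCM A d X ∧ ∀ (Z : Type) [AddCommGroup Z] [Module A Z], IsMCM A d Z →
    ∀ f : Z →ₗ[A] M, ∃ g : Z →ₗ[A] X, π ∘ₗ g = f

/-- `π : X → M` is a special CM-precover: a CM-precover with
`Ext^1(Z, ker π) = 0` for all maximal Cohen-Macaulay `Z`. -/
def IsSpecialCMPrecover (A : Type) [CommRing A] [IsLocalRing A] (d : ℕ) {X M : Type}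
    [AddCommGroup X] [Module A X] [AddCommGroup M] [Module A M] (π : X →ₗ[A] M) : Prop :=
  IsCMPrecover A d π ∧ ∀ (Z : Type) [AddCommGroup Z] [Module A Z], IsMCM A d Z →
    Subsingleton (ext1 A 1 Z ↥(LinearMap.ker π))

/-- `π : X → M` is a CM-cover. -/
def IsCMCover (A : Type) [CommRing A] [IsLocalRing A] (d : ℕ) {X M : Type}
    [AddCommGroup X] [Module A X] [AddCommGroup M] [Module A M] (π : X →ₗ[A] M) : Prop :=
  IsCMPrecover A d π ∧ ∀ φ : X →ₗ[A] X, π ∘ₗ φ = π → Function.Bijective φ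

/-- `M` has no nonzero free direct summand. -/
def NoNonzeroFreeSummand (A : Type) [CommRing A] (M : Type) [AddCommGroup M]
    [Module A M] : Prop :=
  ∀ F G : Submodule A M, IsCompl F G → Module.Free A ↥F → F = ⊥

/-- `W` belongs to `add ω`: it is a direct summand of a finite direct sum of copies of `ω`. -/
def InAdd (A : Type) [CommRing A] (ω : Type) [AddCommGroup ω] [Module A ω] (W : Type)
    [AddCommGroup W] [Module A W] : Prop :=
  ∃ (n : ℕ) (W' : ModuleCat.{0} A), Nonempty ((W × ↥W') ≃ₗ[A] (Fin n → ω))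

section delta

variable (A : Type) [CommRing A] (ω : Type) [AddCommGroup ω] [Module A ω]

/-- The natural evaluation map `δ_M : M → M†† = Hom(Hom(M, ω), ω)`. -/
def deltaMap (M : Type) [AddCommGroup M] [Module A M] :
    M →ₗ[A] ((M →ₗ[A] ω) →ₗ[A] ω) :=
  (LinearMap.id : (M →ₗ[A] ω) →ₗ[A] (M →ₗ[A] ω)).flip

/-- The dual `f† = Hom(f, ω)` of a linear map `f`. -/
def dmap {M N : Type} [AddCommGroup M] [Module A M] [AddCommGroup N] [Module A N]
    (f : M →ₗ[A] N) : (N →ₗ[A] ω) →ₗ[A] (M →ₗ[A] ω) :=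
  LinearMap.lcomp A ω f

end delta

/-- The homology `ker g / im f` at the middle spot of `M → N → P`. -/
abbrev homMod (A : Type) [CommRing A] {M N P : Type} [AddCommGroup M] [Module A M]
    [AddCommGroup N] [Module A N] [AddCommGroup P] [Module A P]
    (f : M →ₗ[A] N) (g : N →ₗ[A] P) : Type :=
  ↥(LinearMap.ker g) ⧸ Submodule.comap (LinearMap.ker g).subtype (LinearMap.range f)

end

open CategoryTheory Abelian Limits

theorem subsingleton_ext1_iff (A : Type) [CommRing A] (n : ℕ) (M N : Type) [AddCommGroup M]
    [Module A M] [AddCommGroup N] [Module A N] :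
    Subsingleton (ext1 A n M N) ↔
      Subsingleton (Abelian.Ext (ModuleCat.of A M) (ModuleCat.of A N) n) := by
  let P := ProjectiveResolution.of (ModuleCat.of A M)
  have e := P.isoExt (R := A) n (ModuleCat.of A N)
  unfold ext1
  rw [← ModuleCat.isZero_iff_subsingleton, e.isZero_iff,
    ← HomologicalComplex.exactAt_iff_isZero_homology]
  cases n with
  | zero =>
    rw [HomologicalComplex.exactAt_iff' _ 0 0 1 (by simp) (by simp),
      ShortComplex.moduleCat_exact_iff, Ext.addEquiv₀.subsingleton_congr]
    have d_zero : (P.complex.linearYonedaObj A (ModuleCat.of A N)).d 0 0 = 0 :=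
      HomologicalComplex.shape _ _ _ (by simp)
    let π : P.complex.X 0 ⟶ ModuleCat.of A M := P.π.f 0
    have d_π : P.complex.d 1 0 ≫ π = 0 := P.complex_d_comp_π_f_zero
    have : Epi π := inferInstanceAs (Epi (P.π.f 0))
    constructor
    · intro h
      refine subsingleton_of_forall_eq 0 fun g => ?_
      obtain ⟨x, hx⟩ := h (π ≫ g) (by
        change P.complex.d 1 0 ≫ π ≫ g = 0
        rw [reassoc_of% d_π, zero_comp])
      have hx' : π ≫ g = 0 := by
        rw [← hx]
        change (P.complex.linearYonedaObj A (ModuleCat.of A N)).d 0 0 x = 0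
        rw [d_zero]
        rfl
      rw [← cancel_epi π, hx', comp_zero]
    · intro h f hf
      have h_desc : π ≫ P.exact₀.desc f hf = f := P.exact₀.g_desc f hf
      have hz : P.exact₀.desc f hf = 0 := h.elim _ _
      exact ⟨0, by rw [map_zero, ← h_desc, hz]; exact comp_zero.symm⟩
  | succ n =>
    rw [HomologicalComplex.exactAt_iff' _ n (n + 1) (n + 2) (by simp) (by simp),
      ShortComplex.moduleCat_exact_iff]
    constructor
    · intro h
      refine subsingleton_of_forall_eq 0 fun α => ?_
      obtain ⟨f, hf, rfl⟩ := P.extMk_surjective α (n + 2) rfl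
      exact (P.extMk_eq_zero_iff f _ _ hf n rfl).2 (h f hf)
    · intro h f hf
      exact (P.extMk_eq_zero_iff f (n + 2) rfl hf n rfl).1 (Subsingleton.elim _ _)
namespace CategoryTheory.ShortComplex.ShortExact

variable {C : Type*} [Category* C] [Abelian C] [HasExt.{0} C] {S : ShortComplex C}

theorem subsingleton_ext_X₁ (hS : S.ShortExact) (X : C) (n : ℕ)
    (h₂ : Subsingleton (Abelian.Ext X S.X₂ (n + 1))) (h₃ : Subsingleton (Abelian.Ext X S.X₃ n)) :
    Subsingleton (Abelian.Ext X S.X₁ (n + 1)) := by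
  refine subsingleton_of_forall_eq 0 fun x => ?_
  obtain ⟨y, rfl⟩ := Ext.covariant_sequence_exact₁ X hS x (Subsingleton.elim _ _) rfl
  rw [Subsingleton.elim y 0, Ext.zero_comp]

theorem subsingleton_ext_zero_X₁ (hS : S.ShortExact) (X : C)
    (h₂ : Subsingleton (Abelian.Ext X S.X₂ 0)) : Subsingleton (Abelian.Ext X S.X₁ 0) := by
  have := hS.mono_f
  exact (Ext.postcomp_mk₀_injective_of_mono X S.f).subsingleton

theorem subsingleton_ext_X₃ (hS : S.ShortExact) (X : C) (n : ℕ)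
    (h₂ : Subsingleton (Abelian.Ext X S.X₂ n)) (h₁ : Subsingleton (Abelian.Ext X S.X₁ (n + 1))) :
    Subsingleton (Abelian.Ext X S.X₃ n) := by
  refine subsingleton_of_forall_eq 0 fun x => ?_
  obtain ⟨y, rfl⟩ := Ext.covariant_sequence_exact₃ X hS x rfl (Subsingleton.elim _ _)
  rw [Subsingleton.elim y 0, Ext.zero_comp]

theorem subsingleton_ext_of_X₁ (hS : S.ShortExact) (Y : C) (n : ℕ)
    (h₂ : Subsingleton (Abelian.Ext S.X₂ Y n)) (h₃ : Subsingleton (Abelian.Ext S.X₃ Y (n + 1))) :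
    Subsingleton (Abelian.Ext S.X₁ Y n) := by
  refine subsingleton_of_forall_eq 0 fun x => ?_
  obtain ⟨y, rfl⟩ := Ext.contravariant_sequence_exact₁ hS Y x (add_comm 1 n) (Subsingleton.elim _ _)
  rw [Subsingleton.elim y 0, Ext.comp_zero]

theorem subsingleton_ext_of_X₂ (hS : S.ShortExact) (Y : C) (n : ℕ)
    (h₁ : Subsingleton (Abelian.Ext S.X₁ Y n)) (h₃ : Subsingleton (Abelian.Ext S.X₃ Y n)) :
    Subsingleton (Abelian.Ext S.X₂ Y n) := by
  refine subsingleton_of_forall_eq 0 fun x => ?_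
  obtain ⟨y, rfl⟩ := Ext.contravariant_sequence_exact₂ hS Y x (Subsingleton.elim _ _)
  rw [Subsingleton.elim y 0, Ext.comp_zero]

theorem subsingleton_ext_of_X₃ (hS : S.ShortExact) (Y : C) (n : ℕ)
    (h₁ : Subsingleton (Abelian.Ext S.X₁ Y n)) (h₂ : Subsingleton (Abelian.Ext S.X₂ Y (n + 1))) :
    Subsingleton (Abelian.Ext S.X₃ Y (n + 1)) := by
  refine subsingleton_of_forall_eq 0 fun x => ?_
  obtain ⟨y, rfl⟩ := Ext.contravariant_sequence_exact₃ hS Y x (Subsingleton.elim _ _) (add_comm 1 n)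
  rw [Subsingleton.elim y 0, Ext.comp_zero]

end CategoryTheory.ShortComplex.ShortExact

theorem LinearMap.shortExact_of_exact {R : Type} [CommRing R] {M₁ M₂ M₃ : Type}
    [AddCommGroup M₁] [Module R M₁] [AddCommGroup M₂] [Module R M₂] [AddCommGroup M₃] [Module R M₃]
    (f : M₁ →ₗ[R] M₂) (g : M₂ →ₗ[R] M₃) (hf : Function.Injective f) (hg : Function.Surjective g)
    (hfg : Function.Exact f g) :
    (ShortComplex.mk (ModuleCat.ofHom f) (ModuleCat.ofHom g)
      (by ext x; exact hfg.apply_apply_eq_zero x)).ShortExact :=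
  ModuleCat.shortComplex_shortExact _ hfg hf hg

section Local

variable {R : Type} [CommRing R] [IsNoetherianRing R] [IsLocalRing R]

open IsLocalRing Pointwise

omit [IsNoetherianRing R] [IsLocalRing R] in
theorem subsingleton_ext_of_linearEquiv {M M' : Type} [AddCommGroup M] [Module R M]
    [AddCommGroup M'] [Module R M'] (e : M ≃ₗ[R] M') (Y : ModuleCat.{0} R) (n : ℕ)
    (h : Subsingleton (Abelian.Ext (ModuleCat.of R M) Y n)) :
    Subsingleton (Abelian.Ext (ModuleCat.of R M') Y n) := by
  refine subsingleton_of_forall_eq 0 fun x => ?_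
  have h₁ : ModuleCat.ofHom e.symm.toLinearMap ≫ ModuleCat.ofHom e.toLinearMap =
      𝟙 (ModuleCat.of R M') := by
    ext y
    simp
  rw [← Ext.mk₀_id_comp x, ← h₁, ← Ext.mk₀_comp_mk₀, Ext.comp_assoc_of_second_deg_zero,
    h.elim ((Ext.mk₀ (ModuleCat.ofHom e.toLinearMap)).comp x (zero_add n)) 0, Ext.comp_zero]

/-- A form of Nakayama's lemma for `Ext(-, W)` along multiplication by a regular element. -/
theorem subsingleton_ext_of_quotSMulTop (M W : Type) [AddCommGroup M] [Module R M]
    [AddCommGroup W] [Module R W] [Module.Finite R M] [Module.Finite R W] {x : R}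
    (hx : x ∈ maximalIdeal R) (reg : IsSMulRegular M x) (n : ℕ)
    (h : Subsingleton (Abelian.Ext (ModuleCat.of R (QuotSMulTop x M)) (ModuleCat.of R W) (n + 1))) :
    Subsingleton (Abelian.Ext (ModuleCat.of R M) (ModuleCat.of R W) n) := by
  have hS : ((ModuleCat.of R M).smulShortComplex x).ShortExact := reg.smulShortComplex_shortExact
  have h_top : (⊤ : Submodule R (Abelian.Ext (ModuleCat.of R M) (ModuleCat.of R W) n)) ≤
      maximalIdeal R • ⊤ := by
    intro ξ _
    have h0 : hS.extClass.comp ξ (add_comm 1 n) = 0 := h.elim _ _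
    obtain ⟨η, rfl⟩ : ∃ η : Abelian.Ext (ModuleCat.of R M) (ModuleCat.of R W) n,
        (Ext.mk₀ (x • 𝟙 (ModuleCat.of R M))).comp η (zero_add n) = ξ :=
      Ext.contravariant_sequence_exact₁ hS (ModuleCat.of R W) ξ _ h0
    rw [Ext.mk₀_smul, Ext.smul_comp, Ext.mk₀_id_comp]
    exact Submodule.smul_mem_smul hx trivial
  have := Submodule.eq_bot_of_le_smul_of_le_jacobson_bot (maximalIdeal R) ⊤
    Module.Finite.fg_top h_top (maximalIdeal_le_jacobson _)
  exact (Submodule.subsingleton_iff R).mp (subsingleton_of_bot_eq_top this.symm)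

theorem exists_isSMulRegular_of_subsingleton_ext_zero (M : Type) [AddCommGroup M] [Module R M]
    [Module.Finite R M]
    (h : Subsingleton (Abelian.Ext (ModuleCat.of R (ResidueField R)) (ModuleCat.of R M) 0)) :
    ∃ x ∈ maximalIdeal R, IsSMulRegular M x := by
  have h₁ : Subsingleton (ModuleCat.of R (ResidueField R) ⟶ ModuleCat.of R M) :=
    Ext.addEquiv₀.subsingleton_congr.mp h
  have h₂ : Subsingleton (ResidueField R →ₗ[R] M) :=
    (ModuleCat.homAddEquiv (M := ModuleCat.of R (ResidueField R))
      (N := ModuleCat.of R M)).symm.subsingleton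
  have : Module.Finite R (ResidueField R) := inferInstance
  obtain ⟨x, hx, reg⟩ := IsSMulRegular.subsingleton_linearMap_iff.mp h₂
  refine ⟨x, ?_, reg⟩
  have : Module.annihilator R (ResidueField R) = maximalIdeal R := Ideal.annihilator_quotient
  rwa [← this]

omit [IsNoetherianRing R] [IsLocalRing R] in
theorem subsingleton_ext_quotSMulTop (X : ModuleCat.{0} R) (M : Type) [AddCommGroup M] [Module R M]
    {x : R} (reg : IsSMulRegular M x) {t : ℕ}
    (h : ∀ j < t + 1, Subsingleton (Abelian.Ext X (ModuleCat.of R M) j)) (j : ℕ) (hj : j < t) :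
    Subsingleton (Abelian.Ext X (ModuleCat.of R (QuotSMulTop x M)) j) :=
  ShortComplex.ShortExact.subsingleton_ext_X₃
    (S := (ModuleCat.of R M).smulShortComplex x) reg.smulShortComplex_shortExact X j
    (h j (by omega)) (h (j + 1) (by omega))

/-- Vanishing of `Ext(-, W)` above a degree can be tested on the residue field. -/
theorem subsingleton_ext_of_residueField (W : Type) [AddCommGroup W] [Module R W]
    [Module.Finite R W] (r : ℕ)
    (h : ∀ j ≥ r, Subsingleton
      (Abelian.Ext (ModuleCat.of R (ResidueField R)) (ModuleCat.of R W) j))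
    (N : Type) [AddCommGroup N] [Module R N] [hN : Module.Finite R N] (j : ℕ) (hj : j ≥ r) :
    Subsingleton (Abelian.Ext (ModuleCat.of R N) (ModuleCat.of R W) j) := by
  have of_subsingleton (N : Type) [AddCommGroup N] [Module R N] [Subsingleton N] (j : ℕ) :
      Subsingleton (Abelian.Ext (ModuleCat.of R N) (ModuleCat.of R W) j) := by
    refine subsingleton_of_forall_eq 0 fun ξ => ?_
    have h0 : 𝟙 (ModuleCat.of R N) = 0 :=
      (ModuleCat.isZero_of_subsingleton (ModuleCat.of R N)).eq_of_src _ _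
    rw [← Ext.mk₀_id_comp ξ, h0, Ext.mk₀_zero, Ext.zero_comp]
  have key : ∀ (p : Ideal R), p.IsPrime → ∀ j ≥ r,
      Subsingleton (Abelian.Ext (ModuleCat.of R (R ⧸ p)) (ModuleCat.of R W) j) := by
    intro p
    induction p using IsNoetherian.induction with
    | hgt p ih =>
    intro hp j hj
    by_cases hm : p = maximalIdeal R
    · subst hm
      exact h j hj
    obtain ⟨x, hxm, hxp⟩ : ∃ x ∈ maximalIdeal R, x ∉ p :=
      SetLike.exists_of_lt (lt_of_le_of_ne (le_maximalIdeal hp.ne_top) hm)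
    have reg : IsSMulRegular (R ⧸ p) x := by
      rw [isSMulRegular_quotient_iff_mem_of_smul_mem]
      exact fun y hy => (hp.mem_or_mem hy).resolve_left hxp
    refine subsingleton_ext_of_quotSMulTop (R ⧸ p) W hxm reg j ?_
    have filt (N : Type) [AddCommGroup N] [Module R N] (hfin : Module.Finite R N) :
        (∀ a ∈ p ⊔ Ideal.span {x}, ∀ n : N, a • n = 0) → ∀ j ≥ r,
        Subsingleton (Abelian.Ext (ModuleCat.of R N) (ModuleCat.of R W) j) := by
      induction hfin using IsNoetherianRing.induction_on_isQuotientEquivQuotientPrime R with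
      | subsingleton N => exact fun _ j _ => of_subsingleton N j
      | quotient N q e =>
        intro ha j hj
        refine subsingleton_ext_of_linearEquiv e.symm _ j ?_
        have hle : p ⊔ Ideal.span {x} ≤ q.1 := by
          intro a haa
          have := ha a haa (e.symm (Submodule.Quotient.mk 1))
          rw [← map_smul, e.symm.map_eq_zero_iff, ← Submodule.Quotient.mk_smul,
            Submodule.Quotient.mk_eq_zero] at this
          simpa using this
        refine ih q.1 (lt_of_le_of_ne (le_sup_left.trans hle) ?_) q.2 j hj
        rintro rfl
        exact hxp (hle (Ideal.mem_sup_right (Ideal.mem_span_singleton_self x)))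
      | exact N₁ N₂ N₃ f g hf hg hfg h₁ h₃ =>
        intro ha j hj
        refine (LinearMap.shortExact_of_exact f g hf hg hfg).subsingleton_ext_of_X₂ _ j
          (h₁ ?_ j hj) (h₃ ?_ j hj)
        · intro a haa n
          apply hf
          rw [map_smul, ha a haa, map_zero]
        · intro a haa n
          obtain ⟨n, rfl⟩ := hg n
          rw [← map_smul, ha a haa, map_zero]
    refine filt (QuotSMulTop x (R ⧸ p)) inferInstance ?_ (j + 1) (by omega)
    intro a ha n
    obtain ⟨n, rfl⟩ := Submodule.Quotient.mk_surjective _ n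
    obtain ⟨n, rfl⟩ := Submodule.Quotient.mk_surjective _ n
    obtain ⟨b, hb, c, hc, rfl⟩ := Submodule.mem_sup.mp ha
    obtain ⟨c, rfl⟩ := Ideal.mem_span_singleton'.mp hc
    rw [← Submodule.Quotient.mk_smul, Submodule.Quotient.mk_eq_zero, add_smul,
      ← Submodule.Quotient.mk_smul, (Submodule.Quotient.mk_eq_zero p (x := b • n)).mpr (Ideal.mul_mem_right n p hb),
      zero_add, mul_comm, mul_smul]
    exact Submodule.smul_mem_pointwise_smul _ _ _ trivial
  revert j
  induction hN using IsNoetherianRing.induction_on_isQuotientEquivQuotientPrime R with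
  | subsingleton N => exact fun j _ => of_subsingleton N j
  | quotient N q e =>
    exact fun j hj => subsingleton_ext_of_linearEquiv e.symm _ j (key q.1 q.2 j hj)
  | exact N₁ N₂ N₃ f g hf hg hfg h₁ h₃ =>
    exact fun j hj => (LinearMap.shortExact_of_exact f g hf hg hfg).subsingleton_ext_of_X₂ _ j
          (h₁ j hj) (h₃ j hj)

/-- Cutting down a module of depth and dimension `t` by a regular sequence of length `t` yields a
module containing a copy of the residue field. -/
theorem exists_residueField_injective (W : Type) [AddCommGroup W] [Module R W] (t : ℕ) :
    ∀ (c : ℕ) (Q : Type) [AddCommGroup Q] [Module R Q] [Module.Finite R Q] [Nontrivial Q],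
    (∀ j < t, Subsingleton
      (Abelian.Ext (ModuleCat.of R (ResidueField R)) (ModuleCat.of R Q) j)) →
    Module.supportDim R Q = t →
    (∀ s > c, Subsingleton (Abelian.Ext (ModuleCat.of R Q) (ModuleCat.of R W) s)) →
    ∃ (Q' : ModuleCat.{0} R) (f : ResidueField R →ₗ[R] Q'), Module.Finite R Q' ∧
      Function.Injective f ∧
      ∀ s > c + t, Subsingleton (Abelian.Ext Q' (ModuleCat.of R W) s) := by
  induction t with
  | zero =>
    intro c Q _ _ _ _ _ hdim hvan
    obtain ⟨p, hp⟩ := associatedPrimes.nonempty R Q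
    have hps : (⟨p, hp.isPrime⟩ : PrimeSpectrum R) ∈ Module.support R Q := by
      rw [Module.support_eq_zeroLocus]
      exact Submodule.annihilator_top.symm.le.trans (IsAssociatedPrime.annihilator_le hp)
    rw [support_of_supportDim_eq_zero (R := R) (N := Q) (by simpa using hdim)] at hps
    have hpm : p = maximalIdeal R :=
      ((maximalIdeal.isMaximal R).eq_of_le hp.isPrime.ne_top hps).symm
    subst hpm
    obtain ⟨f, hf⟩ : ∃ f : (R ⧸ maximalIdeal R) →ₗ[R] Q, Function.Injective f :=
      ((isAssociatedPrime_iff_exists_injective_linearMap _ _).mp hp).2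
    exact ⟨ModuleCat.of R Q, f, inferInstance, hf, hvan⟩
  | succ t ih =>
    intro c Q _ _ _ _ hdepth hdim hvan
    obtain ⟨x, hx, reg⟩ := exists_isSMulRegular_of_subsingleton_ext_zero Q (hdepth 0 (by omega))
    have : Nontrivial (QuotSMulTop x Q) := nontrivial_quotSMulTop_of_mem_maximalIdeal Q hx
    have hdim' : Module.supportDim R (QuotSMulTop x Q) = t := by
      have := Module.supportDim_quotSMulTop_succ_eq_supportDim reg hx
      rw [hdim] at this
      generalize Module.supportDim R (QuotSMulTop x Q) = a at this ⊢
      induction a with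
      | bot => exact absurd this WithBot.bot_ne_coe
      | coe a =>
        induction a with
        | top => exact absurd (WithBot.coe_injective this) (ENat.top_ne_natCast (t + 1))
        | coe a => norm_cast at this ⊢; omega
    obtain ⟨Q', f, hfin, hf, h⟩ := ih (c + 1) (QuotSMulTop x Q)
      (subsingleton_ext_quotSMulTop _ Q reg hdepth) hdim' (by
        intro s hs
        obtain ⟨s, rfl⟩ := Nat.exists_eq_add_of_le' (show 1 ≤ s by omega)
        exact ShortComplex.ShortExact.subsingleton_ext_of_X₃
          (S := (ModuleCat.of R Q).smulShortComplex x) reg.smulShortComplex_shortExact _ s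
          (hvan s (by omega)) (hvan (s + 1) (by omega)))
    exact ⟨Q', f, hfin, hf, fun s hs => h s (by omega)⟩

/-- Over a Cohen-Macaulay local ring of dimension `d`, a finitely generated module of finite
injective dimension has injective dimension at most `d`. -/
theorem subsingleton_ext_of_gt_dim (d : ℕ) (hdim : ringKrullDim R = d)
    (hCM : ∀ j < d, Subsingleton
      (Abelian.Ext (ModuleCat.of R (ResidueField R)) (ModuleCat.of R R) j))
    (W : Type) [AddCommGroup W] [Module R W] [Module.Finite R W] (e : ℕ)
    (h : ∀ (N : Type) [AddCommGroup N] [Module R N] [Module.Finite R N], ∀ j > d + e,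
      Subsingleton (Abelian.Ext (ModuleCat.of R N) (ModuleCat.of R W) j))
    (N : Type) [AddCommGroup N] [Module R N] [Module.Finite R N] (j : ℕ) (hj : j > d) :
    Subsingleton (Abelian.Ext (ModuleCat.of R N) (ModuleCat.of R W) j) := by
  induction e with
  | zero => exact h N j hj
  | succ e ih =>
    refine ih fun N _ _ _ j hj => ?_
    refine subsingleton_ext_of_residueField W (d + e + 1) (fun j hj => ?_) N j hj
    obtain ⟨Q, f, hfin, hf, hQ⟩ := exists_residueField_injective W d 0 R hCM
      (by rw [Module.supportDim_self_eq_ringKrullDim, hdim]) (fun s hs => by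
        obtain ⟨s, rfl⟩ := Nat.exists_eq_add_of_le' (show 1 ≤ s by omega)
        exact subsingleton_of_forall_eq 0 fun ξ => Ext.eq_zero_of_projective ξ)
    exact (LinearMap.shortExact_of_exact f f.range.mkQ hf (Submodule.mkQ_surjective _)
      (LinearMap.exact_map_mkQ_range f)).subsingleton_ext_of_X₁ _ j
      (hQ j (by omega)) (h (Q ⧸ f.range) (j + 1) (by omega))

theorem subsingleton_ext_of_depth (d : ℕ) (W : Type) [AddCommGroup W] [Module R W]
    [Module.Finite R W]
    (h : ∀ (N : Type) [AddCommGroup N] [Module R N] [Module.Finite R N], ∀ j > d,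
      Subsingleton (Abelian.Ext (ModuleCat.of R N) (ModuleCat.of R W) j)) (t : ℕ) :
    ∀ (Z : Type) [AddCommGroup Z] [Module R Z] [Module.Finite R Z],
    (∀ j < t, Subsingleton
      (Abelian.Ext (ModuleCat.of R (ResidueField R)) (ModuleCat.of R Z) j)) →
    ∀ i, i + t > d → Subsingleton (Abelian.Ext (ModuleCat.of R Z) (ModuleCat.of R W) i) := by
  induction t with
  | zero => exact fun Z _ _ _ _ i hi => h Z i hi
  | succ t ih =>
    intro Z _ _ _ hZ i hi
    obtain ⟨x, hx, reg⟩ := exists_isSMulRegular_of_subsingleton_ext_zero Z (hZ 0 (by omega))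
    exact subsingleton_ext_of_quotSMulTop Z W hx reg i
      (ih (QuotSMulTop x Z) (subsingleton_ext_quotSMulTop _ Z reg hZ) (i + 1) (by omega))

omit [IsNoetherianRing R] [IsLocalRing R] in
theorem subsingleton_ext_hom_fin (X : ModuleCat.{0} R) (W : Type) [AddCommGroup W] [Module R W]
    (n j : ℕ) (h : Subsingleton (Abelian.Ext X (ModuleCat.of R W) j)) :
    Subsingleton (Abelian.Ext X (ModuleCat.of R ((Fin n → R) →ₗ[R] W)) j) := by
  let a (i : Fin n) : ModuleCat.of R ((Fin n → R) →ₗ[R] W) ⟶ ModuleCat.of R W :=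
    ModuleCat.ofHom (LinearMap.applyₗ (Pi.single i 1))
  let b (i : Fin n) : ModuleCat.of R W ⟶ ModuleCat.of R ((Fin n → R) →ₗ[R] W) :=
    ModuleCat.ofHom (LinearMap.smulRightₗ (LinearMap.proj i))
  have hab : 𝟙 (ModuleCat.of R ((Fin n → R) →ₗ[R] W)) = ∑ i, a i ≫ b i := by
    refine ModuleCat.hom_ext (LinearMap.ext fun φ => LinearMap.pi_ext' fun k => ?_)
    ext
    simp [a, b, Pi.single_apply]
  refine subsingleton_of_forall_eq 0 fun ξ => ?_
  rw [← Ext.comp_mk₀_id ξ, hab, Ext.mk₀_sum, Ext.comp_sum]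
  refine Finset.sum_eq_zero fun i _ => ?_
  rw [← Ext.mk₀_comp_mk₀, ← Ext.comp_assoc_of_third_deg_zero,
    h.elim (ξ.comp (Ext.mk₀ (a i)) (add_zero j)) 0, Ext.zero_comp]

omit [IsNoetherianRing R] [IsLocalRing R] in
theorem exists_lift_of_subsingleton_ext_one {K F Z W : Type} [AddCommGroup K] [Module R K]
    [AddCommGroup F] [Module R F] [AddCommGroup Z] [Module R Z] [AddCommGroup W] [Module R W]
    (i : K →ₗ[R] F) (p : F →ₗ[R] Z) (hi : Function.Injective i) (hp : Function.Surjective p)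
    (hip : Function.Exact i p)
    (h : Subsingleton (Abelian.Ext (ModuleCat.of R Z) (ModuleCat.of R W) 1)) (φ : K →ₗ[R] W) :
    ∃ ψ : F →ₗ[R] W, ψ ∘ₗ i = φ := by
  obtain ⟨x, hx⟩ := Ext.contravariant_sequence_exact₁ (LinearMap.shortExact_of_exact i p hi hp hip)
    (ModuleCat.of R W) (Ext.mk₀ (ModuleCat.ofHom φ)) (add_zero 1) (h.elim _ _)
  obtain ⟨ψ, rfl⟩ := Ext.addEquiv₀.symm.surjective x
  refine ⟨ψ.hom, ?_⟩
  rw [Ext.addEquiv₀_symm_apply, Ext.mk₀_comp_mk₀] at hx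
  exact congrArg ModuleCat.Hom.hom (Ext.addEquiv₀.symm.injective hx)

omit [IsLocalRing R] in
/-- If `Ext^i(Z, W)` vanishes in positive degrees and `depth W ≥ d`, then
`depth Hom(Z, W) ≥ d`. -/
theorem subsingleton_ext_hom (X : ModuleCat.{0} R) (d : ℕ) (W : Type) [AddCommGroup W] [Module R W]
    (hW : ∀ j < d, Subsingleton (Abelian.Ext X (ModuleCat.of R W) j)) (t : ℕ) (ht : t ≤ d) :
    ∀ (Z : Type) [AddCommGroup Z] [Module R Z] [Module.Finite R Z],
    (∀ i > 0, Subsingleton (Abelian.Ext (ModuleCat.of R Z) (ModuleCat.of R W) i)) →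
    ∀ j < t, Subsingleton (Abelian.Ext X (ModuleCat.of R (Z →ₗ[R] W)) j) := by
  induction t with
  | zero => exact fun Z _ _ _ _ j hj => absurd hj (by omega)
  | succ t ih =>
    intro Z _ _ _ hZ j hj
    obtain ⟨n, p, hp⟩ := Module.Finite.exists_fin' R Z
    have hi := p.ker.injective_subtype
    have hip := p.exact_subtype_ker_map
    have hK : ∀ i > 0, Subsingleton (Abelian.Ext (ModuleCat.of R p.ker) (ModuleCat.of R W) i) := by
      intro i hpos
      refine (LinearMap.shortExact_of_exact _ p hi hp hip).subsingleton_ext_of_X₁ _ i ?_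
        (hZ (i + 1) (by omega))
      obtain ⟨i, rfl⟩ := Nat.exists_eq_add_of_le' (show 1 ≤ i by omega)
      exact subsingleton_of_forall_eq 0 fun ξ => Ext.eq_zero_of_projective ξ
    have hF := subsingleton_ext_hom_fin X W n j (hW j (by omega))
    have hS := LinearMap.shortExact_of_exact (LinearMap.lcomp R W p)
      (LinearMap.lcomp R W p.ker.subtype)
      (LinearMap.lcomp_injective_of_surjective p hp)
      (exists_lift_of_subsingleton_ext_one _ p hi hp hip (hZ 1 (by omega)))
      (LinearMap.exact_lcomp_of_exact_of_surjective W hip hp)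
    cases j with
    | zero => exact hS.subsingleton_ext_zero_X₁ X hF
    | succ j => exact hS.subsingleton_ext_X₁ X j hF (ih (by omega) p.ker hK j (by omega))

end Local

theorem le_rdepth_iff (A : Type) [CommRing A] [IsLocalRing A] (d : ℕ) (M : Type) [AddCommGroup M]
    [Module A M] :
    (d : ℕ∞) ≤ rdepth A M ↔ ∀ j < d, Subsingleton (Abelian.Ext
      (ModuleCat.of A (IsLocalRing.ResidueField A)) (ModuleCat.of A M) j) := by
  simp only [rdepth, le_sInf_iff, Set.mem_ofPred_eq, subsingleton_ext1_iff]
  constructor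
  · intro h j hj
    by_contra hne
    exact absurd (Nat.cast_le.mp (h j ⟨j, rfl, hne⟩)) (by omega)
  · rintro h _ ⟨j, rfl, hne⟩
    by_contra! hlt
    exact hne (h j (Nat.cast_lt.mp hlt))

/-- The canonical dual of a maximal Cohen-Macaulay module is maximal Cohen-Macaulay. -/
theorem IsMCM.dual {R : Type} [CommRing R] [IsNoetherianRing R] [IsLocalRing R]
    {d : ℕ} (hdim : ringKrullDim R = d) (hCM : (d : ℕ∞) ≤ rdepth R R)
    {ω : Type} [AddCommGroup ω] [Module R ω] (hω : IsCanonicalModule R d ω)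
    {Z : Type} [AddCommGroup Z] [Module R Z] (hZ : IsMCM R d Z) : IsMCM R d (Z →ₗ[R] ω) := by
  obtain ⟨⟨hω_fin, hω_depth⟩, ⟨n, hn⟩, -⟩ := hω
  obtain ⟨hZ_fin, hZ_depth⟩ := hZ
  rw [le_rdepth_iff] at hCM hω_depth hZ_depth
  have hinj := subsingleton_ext_of_gt_dim d hdim hCM ω n fun N _ _ _ j hj =>
    (subsingleton_ext1_iff R j N ω).mp (hn N j (by omega))
  refine ⟨inferInstance, (le_rdepth_iff R d _).mpr ?_⟩
  exact subsingleton_ext_hom _ d ω hω_depth d le_rfl Z fun i hi =>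
    subsingleton_ext_of_depth d ω hinj d Z hZ_depth i (by omega)

/-- if `μ : M → X` is a CM-preenvelope, then `μ† : X† → M†` is a CM-precover. -/
theorem dual_of_cm_preenvelope (R : Type) [CommRing R] [IsNoetherianRing R] [IsLocalRing R]
    (d : ℕ) (hdim : ringKrullDim R = d) (hCM : (d : ℕ∞) ≤ rdepth R R)
    (ω : Type) [AddCommGroup ω] [Module R ω] (hω : IsCanonicalModule R d ω)
    (M X : Type) [AddCommGroup M] [Module R M] [AddCommGroup X] [Module R X]
    [Module.Finite R M] (μ : M →ₗ[R] X) (h : IsCMPreenvelope R d μ) :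
    IsCMPrecover R d (dmap R ω μ) := by
  refine ⟨h.1.dual hdim hCM hω, fun Z _ _ hZ f => ?_⟩
  obtain ⟨g, hg⟩ := h.2 (Z →ₗ[R] ω) (hZ.dual hdim hCM hω) f.flip
  refine ⟨g.flip, ?_⟩
  ext z m
  exact LinearMap.congr_fun (LinearMap.congr_fun hg m) z
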